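/- (Monotonicity of SlideVaR.) Let X₁ and X₂ be integrable random variables with X₁ ≥ X₂ almost surely. Then SlideVaR_{α,β}^φ(X₁) ≥ SlideVaR_{α,β}^φ(X₂). -/

import Mathlib

open MeasureTheory

/-- Quantile function `F_X^{-1}(p) = inf {x : F_X(x) >= p}` of the loss `X` under `P`. -/
noncomputable def quantile {Ω : Type*} [MeasurableSpace Ω] (P : Measure Ω)
    (X : Ω → ℝ) (p : ℝ) : ℝ :=
  sInf {x : ℝ | p ≤ (P {ω | X ω ≤ x}).toReal}

/-- Tail thickness `U_β^φ(X) = ∫_0^1 F_X^{-1}(p) φ_β(p) dp`. -/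
noncomputable def tailThickness {Ω : Type*} [MeasurableSpace Ω] (P : Measure Ω)
    (φ : ℝ → ℝ) (X : Ω → ℝ) : ℝ :=
  ∫ p in (0:ℝ)..1, quantile P X p * φ p

/-- Value at risk `VaR_α(X) = F_X^{-1}(α)`. -/
noncomputable def VaR {Ω : Type*} [MeasurableSpace Ω] (P : Measure Ω)
    (α : ℝ) (X : Ω → ℝ) : ℝ :=
  quantile P X α

/-- Conditional value at risk `CVaR_α(X) = (1/(1-α)) ∫_α^1 F_X^{-1}(p) dp`. -/
noncomputable def CVaR {Ω : Type*} [MeasurableSpace Ω] (P : Measure Ω)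
    (α : ℝ) (X : Ω → ℝ) : ℝ :=
  (1 / (1 - α)) * ∫ p in α..1, quantile P X p

/-- `SlideVaR_{α,β}^φ(X) = S(U_β^φ(X))·CVaR_α(X) + (1 - S(U_β^φ(X)))·VaR_β(X)`. -/
noncomputable def SlideVaR {Ω : Type*} [MeasurableSpace Ω] (P : Measure Ω)
    (α β : ℝ) (φ S : ℝ → ℝ) (X : Ω → ℝ) : ℝ :=
  S (tailThickness P φ X) * CVaR P α X
    + (1 - S (tailThickness P φ X)) * VaR P β X

section Quantile

variable {Ω : Type*} [MeasurableSpace Ω] {P : Measure Ω} [IsProbabilityMeasure P] {X Y : Ω → ℝ}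

/-- The distribution function of `X` is the cumulative distribution function of its law. -/
theorem toReal_measure_le_eq_cdf (hX : AEMeasurable X P) (x : ℝ) :
    (P {ω | X ω ≤ x}).toReal = ProbabilityTheory.cdf (P.map X) x := by
  have := Measure.isProbabilityMeasure_map hX
  rw [ProbabilityTheory.cdf_eq_real, Measure.real,
    Measure.map_apply_of_aemeasurable hX measurableSet_Iic]
  rfl

theorem nonempty_setOf_le_cdf (hX : AEMeasurable X P) {p : ℝ} (hp : p < 1) :
    {x : ℝ | p ≤ (P {ω | X ω ≤ x}).toReal}.Nonempty := by
  simp only [toReal_measure_le_eq_cdf hX]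
  exact ((ProbabilityTheory.tendsto_cdf_atTop (P.map X)).eventually (eventually_ge_nhds hp)).exists

theorem bddBelow_setOf_le_cdf (hX : AEMeasurable X P) {p : ℝ} (hp : 0 < p) :
    BddBelow {x : ℝ | p ≤ (P {ω | X ω ≤ x}).toReal} := by
  simp only [toReal_measure_le_eq_cdf hX]
  obtain ⟨a, ha⟩ :=
    ((ProbabilityTheory.tendsto_cdf_atBot (P.map X)).eventually (eventually_lt_nhds hp)).exists
  refine ⟨a, fun x hx => le_of_not_gt fun hxa => ?_⟩
  exact (hx.trans (ProbabilityTheory.monotone_cdf _ hxa.le)).not_gt ha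

/-- The quantile function is the lower adjoint of the distribution function. -/
theorem quantile_le_iff (hX : AEMeasurable X P) {p : ℝ} (hp : p ∈ Set.Ioo (0 : ℝ) 1) (x : ℝ) :
    quantile P X p ≤ x ↔ p ≤ (P {ω | X ω ≤ x}).toReal := by
  refine ⟨fun h => ?_, fun h => csInf_le (bddBelow_setOf_le_cdf hX hp.1) h⟩
  rw [toReal_measure_le_eq_cdf hX]
  have hright := (ProbabilityTheory.cdf (P.map X)).right_continuous x
  refine ge_of_tendsto (hright.tendsto.mono_left (nhdsWithin_mono _ Set.Ioi_subset_Ici_self)) ?_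
  filter_upwards [self_mem_nhdsWithin] with y hy
  obtain ⟨z, hz, hzy⟩ := exists_lt_of_csInf_lt (nonempty_setOf_le_cdf hX hp.2)
    (lt_of_le_of_lt h hy)
  rw [Set.mem_ofPred_eq, toReal_measure_le_eq_cdf hX] at hz
  exact hz.trans (ProbabilityTheory.monotone_cdf _ hzy.le)

theorem monotoneOn_quantile (hX : AEMeasurable X P) :
    MonotoneOn (quantile P X) (Set.Ioo 0 1) := fun _ hp _ hq hpq =>
  (quantile_le_iff hX hp _).2 (hpq.trans ((quantile_le_iff hX hq _).1 le_rfl))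

theorem quantile_le_quantile (hX : AEMeasurable X P) (hY : AEMeasurable Y P)
    (h : ∀ᵐ ω ∂P, X ω ≤ Y ω) {p : ℝ} (hp : p ∈ Set.Ioo (0 : ℝ) 1) :
    quantile P X p ≤ quantile P Y p := by
  refine (quantile_le_iff hX hp _).2 (((quantile_le_iff hY hp _).1 le_rfl).trans ?_)
  refine ENNReal.toReal_mono (measure_ne_top _ _) (measure_mono_ae ?_)
  filter_upwards [h] with ω hω hYω using hω.trans hYω

theorem aemeasurable_quantile (hX : AEMeasurable X P) :
    AEMeasurable (quantile P X) (volume.restrict (Set.Ioo 0 1)) :=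
  aemeasurable_restrict_of_monotoneOn measurableSet_Ioo (monotoneOn_quantile hX)

/-- The quantile function of `X` at a uniform random level has the law of `X`. -/
theorem map_quantile (hX : AEMeasurable X P) :
    (volume.restrict (Set.Ioo (0 : ℝ) 1)).map (quantile P X) = P.map X := by
  have : IsFiniteMeasure (volume.restrict (Set.Ioo (0 : ℝ) 1)) := ⟨by simp⟩
  refine Measure.ext_of_Iic _ _ fun x => ?_
  rw [Measure.map_apply_of_aemeasurable (aemeasurable_quantile hX) measurableSet_Iic,
    Measure.map_apply_of_aemeasurable hX measurableSet_Iic,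
    Measure.restrict_apply' measurableSet_Ioo]
  have hset : quantile P X ⁻¹' Set.Iic x ∩ Set.Ioo 0 1
      = Set.Iic (P {ω | X ω ≤ x}).toReal ∩ Set.Ioo 0 1 := by
    ext p
    simp only [Set.mem_inter_iff, Set.mem_preimage, Set.mem_Iic]
    exact and_congr_left fun hp => quantile_le_iff hX hp x
  have hle : (P {ω | X ω ≤ x}).toReal ≤ 1 := measureReal_le_one
  have hae : (Set.Iic (P {ω | X ω ≤ x}).toReal ∩ Set.Ioo 0 1 : Set ℝ)
      =ᵐ[volume] Set.Ioc 0 (P {ω | X ω ≤ x}).toReal := by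
    have hIoc : Set.Ioc 0 (P {ω | X ω ≤ x}).toReal
        = Set.Iic (P {ω | X ω ≤ x}).toReal ∩ Set.Ioc 0 1 := by
      ext p
      simp only [Set.mem_inter_iff, Set.mem_Ioc, Set.mem_Iic]
      grind
    rw [hIoc]
    exact (ae_eq_refl _).inter Ioo_ae_eq_Ioc
  rw [hset, measure_congr hae, Real.volume_Ioc, sub_zero,
    ENNReal.ofReal_toReal (measure_ne_top _ _)]
  rfl

theorem integrableOn_quantile (hX : Integrable X P) :
    IntegrableOn (quantile P X) (Set.Ioo 0 1) := by
  have hid : Integrable id (P.map X) :=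
    (integrable_map_measure aestronglyMeasurable_id hX.aemeasurable).2 hX
  rw [← map_quantile hX.aemeasurable] at hid
  exact (integrable_map_measure aestronglyMeasurable_id
    (aemeasurable_quantile hX.aemeasurable)).1 hid

theorem intervalIntegrable_quantile (hX : Integrable X P) {a : ℝ} (ha : 0 ≤ a) (ha1 : a ≤ 1) :
    IntervalIntegrable (quantile P X) volume a 1 := by
  rw [intervalIntegrable_iff_integrableOn_Ioo_of_le ha1]
  exact (integrableOn_quantile hX).mono_set (Set.Ioo_subset_Ioo_left ha)

theorem intervalIntegrable_quantile_mul (hX : Integrable X P) {φ : ℝ → ℝ} {C : ℝ}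
    (hφ : IntervalIntegrable φ volume 0 1) (hC : ∀ p ∈ Set.Ioo (0 : ℝ) 1, |φ p| ≤ C) :
    IntervalIntegrable (fun p => quantile P X p * φ p) volume 0 1 := by
  rw [intervalIntegrable_iff_integrableOn_Ioo_of_le zero_le_one] at hφ ⊢
  refine (integrableOn_quantile hX).mul_bdd (c := C) hφ.aestronglyMeasurable ?_
  filter_upwards [ae_restrict_mem measurableSet_Ioo] with p hp using hC p hp

theorem CVaR_mono {α : ℝ} (hα0 : 0 ≤ α) (hα1 : α < 1) (hX : Integrable X P)
    (hY : Integrable Y P) (h : ∀ᵐ ω ∂P, X ω ≤ Y ω) : CVaR P α X ≤ CVaR P α Y := by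
  refine mul_le_mul_of_nonneg_left ?_ (one_div_nonneg.2 (sub_nonneg.2 hα1.le))
  exact intervalIntegral.integral_mono_on_of_le_Ioo hα1.le
    (intervalIntegrable_quantile hX hα0 hα1.le) (intervalIntegrable_quantile hY hα0 hα1.le)
    fun p hp => quantile_le_quantile hX.aemeasurable hY.aemeasurable h
      ⟨hα0.trans_lt hp.1, hp.2⟩

theorem VaR_le_CVaR {α β : ℝ} (hβ : 0 < β) (hβα : β ≤ α) (hα : α < 1) (hX : Integrable X P) :
    VaR P β X ≤ CVaR P α X := by
  have hconst : ∫ _ in α..1, VaR P β X ≤ ∫ p in α..1, quantile P X p :=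
    intervalIntegral.integral_mono_on_of_le_Ioo hα.le intervalIntegrable_const
      (intervalIntegrable_quantile hX (hβ.le.trans hβα) hα.le)
      fun p hp => monotoneOn_quantile hX.aemeasurable ⟨hβ, hβα.trans_lt hα⟩
        ⟨(hβ.trans_le hβα).trans hp.1, hp.2⟩ (hβα.trans hp.1.le)
  rw [intervalIntegral.integral_const, smul_eq_mul] at hconst
  rw [CVaR, one_div_mul_eq_div, le_div_iff₀ (sub_pos.2 hα), mul_comm]
  exact hconst

theorem tailThickness_mono {φ : ℝ → ℝ} {C : ℝ} (hφ : IntervalIntegrable φ volume 0 1)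
    (hφC : ∀ p ∈ Set.Ioo (0 : ℝ) 1, φ p ∈ Set.Icc 0 C)
    (hX : Integrable X P) (hY : Integrable Y P) (h : ∀ᵐ ω ∂P, X ω ≤ Y ω) :
    tailThickness P φ X ≤ tailThickness P φ Y := by
  have hC : ∀ p ∈ Set.Ioo (0 : ℝ) 1, |φ p| ≤ C := fun p hp =>
    (abs_of_nonneg (hφC p hp).1).trans_le (hφC p hp).2
  exact intervalIntegral.integral_mono_on_of_le_Ioo zero_le_one
    (intervalIntegrable_quantile_mul hX hφ hC) (intervalIntegrable_quantile_mul hY hφ hC)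
    fun p hp => mul_le_mul_of_nonneg_right
      (quantile_le_quantile hX.aemeasurable hY.aemeasurable h hp) (hφC p hp).1

end Quantile

theorem slideVaR_mono
    {Ω : Type*} [MeasurableSpace Ω] (P : Measure Ω) [IsProbabilityMeasure P]
    (α β : ℝ) (hβ : 0 < β) (hβα : β ≤ α) (hα : α < 1) (φ : ℝ → ℝ)
    (hφ0 : ∀ p ∈ Set.Ico (0:ℝ) β, φ p = 0)
    (hφpos : ∀ p ∈ Set.Icc β 1, 0 ≤ φ p)
    (hφmono : MonotoneOn φ (Set.Icc β 1))
    (hφnorm : ∫ p in (0:ℝ)..1, φ p = 1)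
    (S : ℝ → ℝ) (hS : Monotone S) (hS01 : ∀ x, S x ∈ Set.Icc (0:ℝ) 1)
    (X₁ X₂ : Ω → ℝ) (hX₁ : Integrable X₁ P) (hX₂ : Integrable X₂ P)
    (hX : ∀ᵐ ω ∂P, X₂ ω ≤ X₁ ω) :
    SlideVaR P α β φ S X₂ ≤ SlideVaR P α β φ S X₁ := by
  have hβ1 : β < 1 := hβα.trans_lt hα
  have hφC : ∀ p ∈ Set.Ioo (0 : ℝ) 1, φ p ∈ Set.Icc 0 (φ 1) := by
    intro p hp
    have h1 : (1 : ℝ) ∈ Set.Icc β 1 := ⟨hβ1.le, le_rfl⟩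
    rcases lt_or_ge p β with hpβ | hpβ
    · rw [hφ0 p ⟨hp.1.le, hpβ⟩]
      exact ⟨le_rfl, hφpos 1 h1⟩
    · exact ⟨hφpos p ⟨hpβ, hp.2.le⟩, hφmono ⟨hpβ, hp.2.le⟩ h1 hp.2.le⟩
  have hφint : IntervalIntegrable φ volume 0 1 :=
    intervalIntegral.intervalIntegrable_of_integral_ne_zero (by rw [hφnorm]; exact one_ne_zero)
  have hs := hS (tailThickness_mono hφint hφC hX₂ hX₁ hX)
  have hC := CVaR_mono (hβ.le.trans hβα) hα hX₂ hX₁ hX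
  have hV : VaR P β X₂ ≤ VaR P β X₁ :=
    quantile_le_quantile hX₂.aemeasurable hX₁.aemeasurable hX ⟨hβ, hβ1⟩
  have hVC := VaR_le_CVaR hβ hβα hα hX₁
  obtain ⟨hs0, hs1⟩ := hS01 (tailThickness P φ X₂)
  unfold SlideVaR
  linarith [mul_le_mul_of_nonneg_left hC hs0, mul_le_mul_of_nonneg_left hV (sub_nonneg.2 hs1),
    mul_le_mul_of_nonneg_right hs (sub_nonneg.2 hVC)]
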